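/- arXiv:2101.09879 — 2 statements merged into one kernel-verified Lean document; each statement's English description precedes it below -/
import Mathlib

section
/- For any given t > 0, C_t := sup_{φ∈A} ‖T_t^−φ‖_∞ < +∞; that is, the set A_t := T_t^−A is bounded in the supremum norm, with bound depending only on t and u_+. -/
/-- For each `t > 0`, the set `A_t := T_t⁻A` is uniformly bounded in the supremum norm:
`C_t := sup_{φ∈A}‖T_t⁻φ‖_∞ < +∞`, where
`A = {φ ∈ C(M,ℝ) : min_{x∈M}(φ(x) − u₊(x)) = 0}`
(encoded: `φ` continuous, `φ ≥ u₊` everywhere, and `φ(x) = u₊(x)` for some `x`).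
The semigroup is represented as `T_t⁻φ(x) = inf_y h_{y,φ(y)}(x,t)` with `h` continuous
on `M × ℝ × M × (0,∞)` and monotone in the value variable, and `T_t⁻u₊ ≥ u₊`. -/
theorem At_uniformly_bounded
    (M : Type*) [MetricSpace M] [CompactSpace M] [Nonempty M]
    (T : ℝ → (M → ℝ) → M → ℝ) (h : M → ℝ → M → ℝ → ℝ)
    (uplus : M → ℝ) (huplus : Continuous uplus)
    (hrep : ∀ φ : M → ℝ, Continuous φ → ∀ t : ℝ, 0 < t → ∀ x,
      T t φ x = ⨅ y : M, h y (φ y) x t)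
    (hcont : ContinuousOn (fun q : M × ℝ × M × ℝ => h q.1 q.2.1 q.2.2.1 q.2.2.2)
      {q : M × ℝ × M × ℝ | 0 < q.2.2.2})
    (hmono : ∀ (x₀ x : M) (t : ℝ), 0 < t → Monotone (fun u : ℝ => h x₀ u x t))
    (hge : ∀ t : ℝ, 0 ≤ t → ∀ x : M, uplus x ≤ T t uplus x) :
    ∀ t : ℝ, 0 < t → ∃ C : ℝ,
      ∀ φ : M → ℝ,
        (Continuous φ ∧ (∀ x, uplus x ≤ φ x) ∧ ∃ x, φ x = uplus x) →
        ∀ x : M, |T t φ x| ≤ C := by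
  intro t ht
  have hg : Continuous (fun p : M × M => h p.1 (uplus p.1) p.2 t) :=
    hcont.comp_continuous
      (f := fun p : M × M => ((p.1, uplus p.1, p.2, t) : M × ℝ × M × ℝ))
      (by fun_prop) (fun _ => ht)
  obtain ⟨B, hB⟩ := isCompact_univ.exists_bound_of_continuousOn hg.continuousOn
  refine ⟨B, ?_⟩
  rintro φ ⟨hφ, hle, y₀, hy₀⟩ x
  have hb : ∀ y, |h y (uplus y) x t| ≤ B := fun y => hB (y, x) (Set.mem_univ _)
  have hlow : ∀ y, -B ≤ h y (φ y) x t := fun y =>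
    (abs_le.mp (hb y)).1.trans (hmono y x t ht (hle y))
  rw [hrep φ hφ t ht x, abs_le]
  refine ⟨le_ciInf hlow, ?_⟩
  refine (ciInf_le ⟨-B, ?_⟩ y₀).trans ?_
  · rintro _ ⟨y, rfl⟩
    exact hlow y
  · rw [hy₀]
    exact (abs_le.mp (hb y₀)).2
end

section
/- For the contact Hamiltonian H(x,u,p) = −2u + p² on the unit circle, the even 1-periodic extension u₁ of the function x ↦ x²/2 from [0,1/2] to ℝ is a viscosity solution of −2u + (u')² = 0. Precisely, let u₁ : ℝ → ℝ be 1-periodic, even, with u₁(x) = x²/2 for x ∈ [0,1/2]; then for every x ∈ ℝ and every C¹ function φ : ℝ → ℝ such that u₁ − φ attains a local maximum at x, one has −2u₁(x) + (φ'(x))² ≤ 0, and for every C¹ function φ such that u₁ − φ attains a local minimum at x, one has −2u₁(x) + (φ'(x))² ≥ 0. -/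
theorem right_nonpos {f : ℝ → ℝ} {d x : ℝ} (hf : HasDerivAt f d x)
    (h : ∀ᶠ y in nhdsWithin x (Set.Ioi x), f y ≤ f x) : d ≤ 0 := by
  have h1 := (hasDerivWithinAt_iff_tendsto_slope' (by simp)).1
    (hf.hasDerivWithinAt (s := Set.Ioi x))
  refine le_of_tendsto h1 ?_
  filter_upwards [h, self_mem_nhdsWithin] with y hy hxy
  rw [slope_def_field]
  have : x < y := hxy
  exact div_nonpos_of_nonpos_of_nonneg (by linarith) (by linarith)

theorem left_nonneg {f : ℝ → ℝ} {d x : ℝ} (hf : HasDerivAt f d x)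
    (h : ∀ᶠ y in nhdsWithin x (Set.Iio x), f y ≤ f x) : 0 ≤ d := by
  have h1 := (hasDerivWithinAt_iff_tendsto_slope' (by simp)).1
    (hf.hasDerivWithinAt (s := Set.Iio x))
  refine ge_of_tendsto h1 ?_
  filter_upwards [h, self_mem_nhdsWithin] with y hy hxy
  rw [slope_def_field]
  have : y < x := hxy
  exact div_nonneg_of_nonpos (by linarith) (by linarith)

/-- For the contact Hamiltonian `H(x,u,p) = -2u + p²` on the circle, the even
1-periodic extension `u₁` of `x ↦ x²/2` from `[0,1/2]` is a viscosity solution of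
`-2u + (u')² = 0`: it is both a viscosity subsolution and a viscosity supersolution. -/
theorem even_periodic_extension_is_viscosity_solution (u₁ : ℝ → ℝ)
    (hper : ∀ x, u₁ (x + 1) = u₁ x)
    (heven : ∀ x, u₁ (-x) = u₁ x)
    (hval : ∀ x ∈ Set.Icc (0 : ℝ) (1 / 2), u₁ x = x ^ 2 / 2) :
    (∀ x : ℝ, ∀ φ : ℝ → ℝ, ContDiff ℝ 1 φ →
      IsLocalMax (fun y => u₁ y - φ y) x → -2 * u₁ x + (deriv φ x) ^ 2 ≤ 0) ∧
    (∀ x : ℝ, ∀ φ : ℝ → ℝ, ContDiff ℝ 1 φ →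
      IsLocalMin (fun y => u₁ y - φ y) x → -2 * u₁ x + (deriv φ x) ^ 2 ≥ 0) := by
  have hp : Function.Periodic u₁ 1 := hper
  have key : ∀ (n : ℤ) (y : ℝ), (n : ℝ) - 1 / 2 ≤ y → y ≤ n + 1 / 2 →
      u₁ y = (y - n) ^ 2 / 2 := by
    intro n y h1 h2
    have e : u₁ y = u₁ (y - n) := by
      have := hp.sub_int_mul_eq (x := y) n
      rw [mul_one] at this
      exact this.symm
    rw [e]
    rcases le_total 0 (y - n) with h | h
    · exact hval _ ⟨h, by linarith⟩
    · rw [← heven, hval _ ⟨by linarith, by linarith⟩]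
      ring
  have hd : ∀ (n : ℤ) (x : ℝ) (φ : ℝ → ℝ), ContDiff ℝ 1 φ →
      HasDerivAt (fun y => (y - n) ^ 2 / 2 - φ y) ((x - n) - deriv φ x) x := by
    intro n x φ hφ
    have h1 : HasDerivAt φ (deriv φ x) x :=
      (hφ.differentiable (by norm_num) x).hasDerivAt
    have h2 := ((((hasDerivAt_id x).sub_const (n : ℝ)).pow 2).div_const 2).sub h1
    have e : (x - n) - deriv φ x = ((2 : ℕ) : ℝ) * (id x - (n : ℝ)) ^ (2 - 1) * 1 / 2 - deriv φ x := by
      simp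
    rw [e]
    exact h2
  constructor
  · intro x φ hφ hmax
    have hn1 := Int.le_ceil (x - 1 / 2)
    have hn2 := Int.ceil_lt_add_one (x - 1 / 2)
    have hm1 := Int.floor_le (x + 1 / 2)
    have hm2 := Int.lt_floor_add_one (x + 1 / 2)
    generalize ⌈x - 1 / 2⌉ = n at *
    generalize ⌊x + 1 / 2⌋ = m at *
    have un := key n x (by linarith) (by linarith)
    have um := key m x (by linarith) (by linarith)
    have ha : 0 ≤ (x - n) - deriv φ x := by
      apply left_nonneg (hd n x φ hφ)
      filter_upwards [hmax.filter_mono nhdsWithin_le_nhds, self_mem_nhdsWithin,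
        mem_nhdsWithin_of_mem_nhds (lt_mem_nhds (show (n : ℝ) - 1 / 2 < x by linarith))]
        with y hy hyx hy2
      have hyx' : y < x := hyx
      have := key n y (by linarith) (by linarith)
      linarith
    have hb : (x - m) - deriv φ x ≤ 0 := by
      apply right_nonpos (hd m x φ hφ)
      filter_upwards [hmax.filter_mono nhdsWithin_le_nhds, self_mem_nhdsWithin,
        mem_nhdsWithin_of_mem_nhds (gt_mem_nhds (show x < (m : ℝ) + 1 / 2 by linarith))]
        with y hy hyx hy2
      have hyx' : x < y := hyx
      have := key m y (by linarith) (by linarith)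
      linarith
    have hab : (x - n) ^ 2 = (x - m) ^ 2 := by linarith
    rcases sq_eq_sq_iff_eq_or_eq_neg.1 hab with h | h
    · have : deriv φ x = x - n := by linarith
      rw [this, un]
      linarith
    · rw [un]
      nlinarith
  · intro x φ hφ hmin
    have hle : ∀ (n : ℤ) (y : ℝ), u₁ y ≤ (y - n) ^ 2 / 2 := by
      intro n y
      have h := abs_le.1 (abs_sub_round y)
      rw [key (round y) y (by linarith) (by linarith)]
      have := sq_le_sq.2 (round_le y n)
      linarith
    have h := abs_le.1 (abs_sub_round x)
    have ux := key (round x) x (by linarith) (by linarith)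
    have hm : IsLocalMin (fun y => (y - (round x : ℤ)) ^ 2 / 2 - φ y) x := by
      filter_upwards [hmin] with y hy
      have := hle (round x) y
      linarith
    have h0 := hm.hasDerivAt_eq_zero (hd (round x) x φ hφ)
    have : deriv φ x = x - round x := by linarith
    rw [this, ux]
    linarith
end
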